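/- Let χ be a nontrivial Dirichlet character of conductor f_χ, k ≥ 0 an integer, and ℓ a prime not dividing f_χ. Then ι(L(-k, χ)) lies in the ring of integers of the algebraic closure of ℚ_ℓ, i.e. ord_ℓ(L(-k, χ)) ≥ 0. -/

import Mathlib

/-!
STATEMENT 6: Let `χ` be a nontrivial Dirichlet character of conductor `f_χ`,
`k ≥ 0`, and `ℓ` a prime not dividing `f_χ`.  Then `ι(L(-k, χ))` lies in the
ring of integers of the algebraic closure of `ℚ_ℓ`, i.e. `ord_ℓ(L(-k,χ)) ≥ 0`.
(We realize `ι` by taking the values of `χ` in `AlgebraicClosure ℚ_[ℓ]`; lying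
in the ring of integers means being integral over `ℤ_ℓ`.)
-/

open scoped BigOperators Classical

/-- The generalized Bernoulli number `B_{n,χ}` computed at the modulus `N` of `χ`:
`∑_{a=1}^{N} χ(a) t e^{at} / (e^{Nt} - 1) = ∑_{n ≥ 0} B_{n,χ} t^n / n!`. -/
noncomputable def genBernoulli {K : Type*} [Field K] [CharZero K] {N : ℕ}
    (χ : DirichletCharacter K N) (n : ℕ) : K :=
  (n.factorial : K) * (PowerSeries.coeff (R := K) n)
    ((∑ a ∈ Finset.Icc 1 N, PowerSeries.C (R := K) (χ (a : ZMod N)) *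
        PowerSeries.rescale ((a : K)) (PowerSeries.exp K)) *
      (PowerSeries.mk fun m => (N : K) ^ (m + 1) / ((m + 1).factorial : K))⁻¹)

/-- The value `L(-k, χ) = -B_{k+1,χ}/(k+1)` of the Dirichlet `L`-function of `χ`
at `s = -k`, computed at the modulus of `χ` (the honest `L`-value when `χ` is
primitive). -/
noncomputable def LvalAt {K : Type*} [Field K] [CharZero K] {N : ℕ}
    (χ : DirichletCharacter K N) (k : ℕ) : K :=
  -genBernoulli χ (k + 1) / (k + 1)

/-- `ℤ_ℓ`-algebra structure on the algebraic closure of `ℚ_ℓ`. -/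
noncomputable instance (ℓ : ℕ) [Fact ℓ.Prime] :
    Algebra ℤ_[ℓ] (AlgebraicClosure ℚ_[ℓ]) :=
  ((algebraMap ℚ_[ℓ] (AlgebraicClosure ℚ_[ℓ])).comp
    (algebraMap ℤ_[ℓ] ℚ_[ℓ])).toAlgebra

/-- Power series whose divided-power coefficients lie in the subring `S`. -/
def InHurwitz {K : Type*} [Field K] (S : Subring K) (f : PowerSeries K) : Prop :=
  ∀ n : ℕ, (n.factorial : K) * PowerSeries.coeff n f ∈ S

theorem fact_mul_split {K : Type*} [Field K] [CharZero K] (a b : K) {n i j : ℕ} (h : i + j = n) :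
    (n.factorial : K) * (a * b) =
      (n.choose i : K) * (((i.factorial : K) * a) * ((j.factorial : K) * b)) := by
  subst h
  have := Nat.add_choose_mul_factorial_mul_factorial i j
  rw [Nat.choose_symm_add.symm] at this
  have h2 : (((i + j).choose i : ℕ) : K) * (i.factorial : K) * (j.factorial : K)
      = ((i + j).factorial : K) := by exact_mod_cast this
  rw [← h2]; ring

theorem InHurwitz.mul {K : Type*} [Field K] [CharZero K] {S : Subring K} {f g : PowerSeries K}
    (hf : InHurwitz S f) (hg : InHurwitz S g) : InHurwitz S (f * g) := by
  intro n
  rw [PowerSeries.coeff_mul, Finset.mul_sum]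
  refine S.sum_mem fun x hx => ?_
  rw [fact_mul_split _ _ (Finset.HasAntidiagonal.mem_antidiagonal.1 hx)]
  exact S.mul_mem (natCast_mem S _) (S.mul_mem (hf _) (hg _))

theorem InHurwitz.inv {K : Type*} [Field K] [CharZero K] {S : Subring K} {f : PowerSeries K}
    (hf : InHurwitz S f) (h0 : (PowerSeries.constantCoeff f)⁻¹ ∈ S) : InHurwitz S f⁻¹ := by
  intro n
  induction n using Nat.strong_induction_on with
  | _ n ih =>
    rw [PowerSeries.coeff_inv]
    split_ifs with hn
    · exact S.mul_mem (natCast_mem S _) h0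
    · rw [mul_left_comm]
      refine S.mul_mem (S.neg_mem h0) ?_
      rw [Finset.mul_sum]
      refine S.sum_mem fun x hx => ?_
      split_ifs with hx2
      · rw [fact_mul_split _ _ (Finset.HasAntidiagonal.mem_antidiagonal.1 hx)]
        exact S.mul_mem (natCast_mem S _) (S.mul_mem (hf _) (ih _ hx2))
      · simp

theorem InHurwitz.sum {K : Type*} [Field K] {S : Subring K} {ι : Type*}
    (s : Finset ι) (f : ι → PowerSeries K)
    (hf : ∀ i ∈ s, InHurwitz S (f i)) : InHurwitz S (∑ i ∈ s, f i) := by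
  intro n
  rw [map_sum, Finset.mul_sum]
  exact S.sum_mem fun i hi => hf i hi n

theorem InHurwitz.const_mul {K : Type*} [Field K] {S : Subring K} {c : K} {f : PowerSeries K}
    (hc : c ∈ S) (hf : InHurwitz S f) : InHurwitz S (PowerSeries.C c * f) := by
  intro n
  rw [PowerSeries.coeff_C_mul, mul_left_comm]
  exact S.mul_mem hc (hf n)

theorem InHurwitz.exp_pow {K : Type*} [Field K] [CharZero K] {S : Subring K} (i : ℕ) :
    InHurwitz S (PowerSeries.exp K ^ i) := by
  intro n
  rw [PowerSeries.exp_pow_eq_rescale_exp, PowerSeries.coeff_rescale, PowerSeries.coeff_exp]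
  have h : (n.factorial : K) ≠ 0 := by exact_mod_cast n.factorial_ne_zero
  have : (n.factorial : K) * ((i : K) ^ n * (algebraMap ℚ K) (1 / (n.factorial : ℚ)))
      = ((i ^ n : ℕ) : K) := by
    simp only [one_div, map_inv₀, map_natCast]
    push_cast
    field_simp
  rw [this]
  exact natCast_mem S _

theorem sum_Icc_char {K : Type*} [Field K] {N : ℕ} (hN : N ≠ 0) (χ : DirichletCharacter K N)
    (hχ : χ ≠ 1) : ∑ a ∈ Finset.Icc 1 N, χ (a : ZMod N) = 0 := by
  have : NeZero N := ⟨hN⟩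
  have h1 : ∑ a ∈ Finset.Icc 1 N, χ (a : ZMod N) = ∑ a ∈ Finset.range N, χ (a : ZMod N) := by
    have e : Finset.Icc 1 N = Finset.Ico 1 (N + 1) := by ext; simp
    rw [e, Finset.sum_Ico_eq_sub _ (by omega), Finset.sum_range_succ]
    simp
  rw [h1, ← MulChar.sum_eq_zero_of_ne_one hχ]
  refine Finset.sum_nbij' (fun a => (a : ZMod N)) (fun x => x.val) ?_ ?_ ?_ ?_ ?_
  · intro a _; simp
  · intro x _; simpa using ZMod.val_lt x
  · intro a ha; exact ZMod.val_cast_of_lt (Finset.mem_range.1 ha)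
  · intro x _; simp
  · intro a _; rfl

theorem mk_pow_fact {K : Type*} [Field K] [CharZero K] (N : ℕ) :
    PowerSeries.X * (PowerSeries.mk fun m => (N : K) ^ (m + 1) / ((m + 1).factorial : K))
      = PowerSeries.exp K ^ N - 1 := by
  ext n
  rw [PowerSeries.exp_pow_eq_rescale_exp]
  cases n with
  | zero => rw [← PowerSeries.exp_pow_eq_rescale_exp]; simp
  | succ n =>
    rw [mul_comm, PowerSeries.coeff_succ_mul_X]
    simp [PowerSeries.coeff_rescale, PowerSeries.coeff_exp, PowerSeries.coeff_one, div_eq_mul_inv]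

theorem LvalAt_mem {K : Type*} [Field K] [CharZero K] (S : Subring K) {N : ℕ} (hN : N ≠ 0)
    (χ : DirichletCharacter K N) (hχ : χ ≠ 1) (hS : ∀ a, χ a ∈ S) (hNS : (N : K)⁻¹ ∈ S) (k : ℕ) :
    LvalAt χ k ∈ S := by
  set e := PowerSeries.exp K with he
  set M : ℕ → PowerSeries K := fun N => PowerSeries.mk fun m =>
    (N : K) ^ (m + 1) / ((m + 1).factorial : K) with hM
  set Q : PowerSeries K := ∑ a ∈ Finset.Icc 1 N, PowerSeries.C (χ (a : ZMod N)) *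
    ∑ i ∈ Finset.range a, e ^ i with hQ
  set P : PowerSeries K := ∑ i ∈ Finset.range N, e ^ i with hP
  have hX : (PowerSeries.X : PowerSeries K) ≠ 0 := PowerSeries.X_ne_zero
  have hE : PowerSeries.X * M 1 = e - 1 := by
    have := mk_pow_fact (K := K) 1
    rwa [pow_one] at this
  have hMN : M N = P * M 1 := by
    apply mul_left_cancel₀ hX
    have h1 : PowerSeries.X * M N = e ^ N - 1 := mk_pow_fact N
    rw [h1, ← geom_sum_mul, ← hE]; ring
  have hA : (∑ a ∈ Finset.Icc 1 N, PowerSeries.C (χ (a : ZMod N)) *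
      PowerSeries.rescale (a : K) e) = PowerSeries.X * (Q * M 1) := by
    have h0 : (∑ a ∈ Finset.Icc 1 N, PowerSeries.C (χ (a : ZMod N))) = (0 : PowerSeries K) := by
      rw [← map_sum, sum_Icc_char hN χ hχ, map_zero]
    have : (∑ a ∈ Finset.Icc 1 N, PowerSeries.C (χ (a : ZMod N)) * PowerSeries.rescale (a : K) e)
      = ∑ a ∈ Finset.Icc 1 N, PowerSeries.C (χ (a : ZMod N)) * (e ^ a - 1) := by
      simp only [mul_sub, mul_one, Finset.sum_sub_distrib, h0, sub_zero]
      simp only [he, PowerSeries.exp_pow_eq_rescale_exp]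
    rw [this, mul_left_comm, hE, hQ, Finset.sum_mul]
    refine Finset.sum_congr rfl fun a _ => ?_
    rw [← geom_sum_mul, mul_assoc]
  have hc : PowerSeries.constantCoeff (M 1) ≠ 0 := by
    simp [hM, ← PowerSeries.coeff_zero_eq_constantCoeff_apply]
  have hPc : PowerSeries.constantCoeff P = (N : K) := by
    simp [hP, he]
  have key : LvalAt χ k = -((k.factorial : K) * PowerSeries.coeff k (Q * P⁻¹)) := by
    unfold LvalAt genBernoulli
    change -(((k + 1).factorial : K) * PowerSeries.coeff (k + 1)
      ((∑ a ∈ Finset.Icc 1 N, PowerSeries.C (χ (a : ZMod N)) *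
      PowerSeries.rescale (a : K) e) * (M N)⁻¹)) / ((k : K) + 1) = _
    have h2 : PowerSeries.X * (Q * M 1) * (M N)⁻¹ = (Q * P⁻¹) * PowerSeries.X := by
      rw [hMN, PowerSeries.mul_inv_rev]
      have := PowerSeries.mul_inv_cancel (M 1) hc
      linear_combination (PowerSeries.X * Q * P⁻¹) * this
    rw [hA, h2, PowerSeries.coeff_succ_mul_X, Nat.factorial_succ]
    have : (k : K) + 1 ≠ 0 := by exact_mod_cast k.succ_ne_zero
    push_cast
    field_simp
  rw [key]
  refine S.neg_mem ?_
  refine InHurwitz.mul ?_ (InHurwitz.inv ?_ ?_) k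
  · exact InHurwitz.sum _ _ fun a _ => InHurwitz.const_mul (hS _)
      (InHurwitz.sum _ _ fun i _ => InHurwitz.exp_pow i)
  · exact InHurwitz.sum _ _ fun i _ => InHurwitz.exp_pow i
  · rwa [hPc]

theorem L_value_integral_at_l (ℓ : ℕ) [Fact ℓ.Prime] {fχ : ℕ}
    (χ : DirichletCharacter (AlgebraicClosure ℚ_[ℓ]) fχ)
    (hχ : χ ≠ 1) (hprim : χ.IsPrimitive) (hl : ¬ ℓ ∣ fχ) (k : ℕ) :
    IsIntegral ℤ_[ℓ] (LvalAt χ k) := by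
  have hN : fχ ≠ 0 := by rintro rfl; exact hl (dvd_zero _)
  have : NeZero fχ := ⟨hN⟩
  refine LvalAt_mem (integralClosure ℤ_[ℓ] (AlgebraicClosure ℚ_[ℓ])).toSubring hN χ hχ ?_ ?_ k
  · intro a
    change IsIntegral ℤ_[ℓ] (χ a)
    by_cases ha : IsUnit a
    · obtain ⟨u, rfl⟩ := ha
      refine IsIntegral.of_pow (n := Fintype.card (ZMod fχ)ˣ) Fintype.card_pos ?_
      rw [← map_pow, ← Units.val_pow_eq_pow_val, pow_card_eq_one]
      simpa using isIntegral_one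
    · rw [χ.map_nonunit ha]; exact isIntegral_zero
  · change IsIntegral ℤ_[ℓ] ((fχ : AlgebraicClosure ℚ_[ℓ])⁻¹)
    have hu : IsUnit (fχ : ℤ_[ℓ]) := by
      rw [PadicInt.isUnit_iff]
      by_contra h
      have h' : ‖((fχ : ℤ) : ℤ_[ℓ])‖ < 1 := lt_of_le_of_ne (PadicInt.norm_le_one _) (by simpa using h)
      rw [PadicInt.norm_int_lt_one_iff_dvd] at h'
      exact hl (by exact_mod_cast h')
    obtain ⟨u, hu⟩ := hu
    have : (fχ : AlgebraicClosure ℚ_[ℓ])⁻¹ = algebraMap ℤ_[ℓ] _ ((u⁻¹ : ℤ_[ℓ]ˣ) : ℤ_[ℓ]) := by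
      refine (eq_inv_of_mul_eq_one_left ?_).symm
      rw [← map_natCast (algebraMap ℤ_[ℓ] (AlgebraicClosure ℚ_[ℓ])) fχ, ← hu, ← map_mul]
      simp
    rw [this]
    exact isIntegral_algebraMap
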